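/- Suppose the matrix A together with γ̄ satisfies Assumption 2, let X(t) be generated by the algorithm X(t+1) = P_{γ̄}(A X(t)) from X(t₀) = X₀ ∈ S(n,d,γ̄), and let Ã(k,t₀,X₀) be the associated product matrices. Then there exists a unit vector v(X₀) ∈ S^{n-1} with all entries strictly positive such that for every i ∈ {1,…,n} the sequence of Euclidean-normalized rows [Ã(k,t₀,X₀)]_i/‖[Ã(k,t₀,X₀)]_i‖₂ converges to v(X₀) as k → ∞, and the convergence is linear (geometric), with a rate that can be chosen independently of i and X₀. -/

import Mathlib

open Finset Filter Topology Matrix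

noncomputable def euclNorm {d : ℕ} (x : Fin d → ℝ) : ℝ := Real.sqrt (∑ j, x j ^ 2)

def unitSphere (d : ℕ) : Set (Fin d → ℝ) := {x | euclNorm x = 1}

/-- A directional function on `S^{d-1}`: continuous and bounded above and below
by positive constants on the unit sphere. -/
def IsDirectional {d : ℕ} (γ : (Fin d → ℝ) → ℝ) : Prop :=
  ContinuousOn γ (unitSphere d) ∧
    ∃ c C : ℝ, 0 < c ∧ ∀ x ∈ unitSphere d, c ≤ γ x ∧ γ x ≤ C

/-- The star boundary `S^{d-1}_γ = {γ(x) x : x ∈ S^{d-1}}`. -/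
def starBoundary {d : ℕ} (γ : (Fin d → ℝ) → ℝ) : Set (Fin d → ℝ) :=
  {y | ∃ x ∈ unitSphere d, y = γ x • x}

/-- `S(n,d,γ̄)`: matrices whose `i`-th row lies on the star boundary of `γ_i`. -/
def Sset (n d : ℕ) (γbar : Fin n → (Fin d → ℝ) → ℝ) : Set (Matrix (Fin n) (Fin d) ℝ) :=
  {X | ∀ i, X i ∈ starBoundary (γbar i)}

/-- Radial projection `P_γ(y) = γ(y/‖y‖₂) · y/‖y‖₂`. -/
noncomputable def radialProj {d : ℕ} (γ : (Fin d → ℝ) → ℝ) (y : Fin d → ℝ) : Fin d → ℝ :=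
  γ ((euclNorm y)⁻¹ • y) • ((euclNorm y)⁻¹ • y)

/-- Row-wise radial projection. -/
noncomputable def rowProj {n d : ℕ} (γbar : Fin n → (Fin d → ℝ) → ℝ)
    (B : Matrix (Fin n) (Fin d) ℝ) : Matrix (Fin n) (Fin d) ℝ :=
  Matrix.of fun i => radialProj (γbar i) (B i)

/-- Assumption 2: each `γ_i` is directional, `A` is a nonnegative weight matrix of a strongly
connected digraph, and the diagonal-dominance condition
`a_ii · min γ_i > Σ_{j≠i} a_ij · max γ_j` holds. -/
def Assumption2 {n d : ℕ} (A : Matrix (Fin n) (Fin n) ℝ)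
    (γbar : Fin n → (Fin d → ℝ) → ℝ) : Prop :=
  (∀ i, IsDirectional (γbar i)) ∧
  (∃ E : Fin n → Fin n → Prop,
    (∀ i j, E i j → 0 < A i j) ∧ (∀ i j, ¬ E i j → A i j = 0) ∧
    (∀ i j, Relation.ReflTransGen E i j)) ∧
  (∀ i, (∑ j ∈ Finset.univ.erase i, A i j * sSup (γbar j '' unitSphere d)) <
      A i i * sInf (γbar i '' unitSphere d))

/-- The trajectory of the algorithm `X(t+1) = P_γ̄(A X(t))`, indexed by `k = t - t₀`. -/
noncomputable def traj {n d : ℕ} (A : Matrix (Fin n) (Fin n) ℝ)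
    (γbar : Fin n → (Fin d → ℝ) → ℝ) (X₀ : Matrix (Fin n) (Fin d) ℝ) :
    ℕ → Matrix (Fin n) (Fin d) ℝ
  | 0 => X₀
  | k + 1 => rowProj γbar (A * traj A γbar X₀ k)

/-- `D_γ̄(B)`: diagonal matrix with entries `γ_i([B]_i/‖[B]_i‖₂)/‖[B]_i‖₂`. -/
noncomputable def Dmat {n d : ℕ} (γbar : Fin n → (Fin d → ℝ) → ℝ)
    (B : Matrix (Fin n) (Fin d) ℝ) : Matrix (Fin n) (Fin n) ℝ :=
  Matrix.diagonal fun i => γbar i ((euclNorm (B i))⁻¹ • B i) / euclNorm (B i)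

/-- The product matrices `Ã(k,t₀,X₀) = D_γ̄(A X(t₀+k−1))A ⋯ D_γ̄(A X(t₀))A`. -/
noncomputable def Atilde {n d : ℕ} (A : Matrix (Fin n) (Fin n) ℝ)
    (γbar : Fin n → (Fin d → ℝ) → ℝ) (X₀ : Matrix (Fin n) (Fin d) ℝ) :
    ℕ → Matrix (Fin n) (Fin n) ℝ
  | 0 => 1
  | k + 1 => Dmat γbar (A * traj A γbar X₀ k) * A * Atilde A γbar X₀ k

/-- `v` is the strictly positive unit vector to which all Euclidean-normalized rows of
`Ã(k,t₀,X₀)` converge. -/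
def IsLimitVec {n d : ℕ} (A : Matrix (Fin n) (Fin n) ℝ)
    (γbar : Fin n → (Fin d → ℝ) → ℝ) (X₀ : Matrix (Fin n) (Fin d) ℝ)
    (v : Fin n → ℝ) : Prop :=
  euclNorm v = 1 ∧ (∀ i, 0 < v i) ∧
    ∀ i, Tendsto (fun k => (euclNorm (Atilde A γbar X₀ k i))⁻¹ • Atilde A γbar X₀ k i)
      atTop (𝓝 v)

/-- Asymptotic consensus of directions. -/
def ConsensusDir {n d : ℕ} (X : ℕ → Matrix (Fin n) (Fin d) ℝ) : Prop :=
  ∀ i j, Tendsto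
    (fun t => euclNorm ((euclNorm (X t i))⁻¹ • X t i - (euclNorm (X t j))⁻¹ • X t j))
    atTop (𝓝 0)

/-- Asymptotic consensus of directions with point-wise convergence to a unit vector. -/
def ConsensusPW {n d : ℕ} (X : ℕ → Matrix (Fin n) (Fin d) ℝ) : Prop :=
  ∃ u : Fin d → ℝ, euclNorm u = 1 ∧
    ∀ i, Tendsto (fun t => (euclNorm (X t i))⁻¹ • X t i) atTop (𝓝 u)

/-- A matrix with entries in `[α, β]`, `0 < α`, contracts the oscillation of the
quotients `y i / r i`. -/
theorem quotient_osc_contract {ι : Type*} [Fintype ι] {W : Matrix ι ι ℝ} {α β : ℝ} (hα : 0 < α)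
    (hβ : 0 < β) (hW : ∀ i j, α ≤ W i j ∧ W i j ≤ β) {r y : ι → ℝ} (hr : ∀ i, 0 < r i)
    {lo hi : ℝ} (hlo : ∀ i, lo * r i ≤ y i) (hhi : ∀ i, y i ≤ hi * r i) (a b : ι) :
    (W *ᵥ y) a / (W *ᵥ r) a - (W *ᵥ y) b / (W *ᵥ r) b ≤
      (1 - (α / β) ^ 2) * (hi - lo) := by
  have compare : ∀ (x : ι → ℝ), (∀ l, 0 ≤ x l) → ∀ i i', α / β * (W *ᵥ x) i' ≤ (W *ᵥ x) i := by
    intro x hx i i'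
    simp only [Matrix.mulVec, dotProduct, Finset.mul_sum]
    refine Finset.sum_le_sum fun l _ => ?_
    rw [← mul_assoc]
    refine mul_le_mul_of_nonneg_right ?_ (hx l)
    calc α / β * W i' l ≤ α / β * β := by gcongr; exact (hW i' l).2
      _ = α := by field_simp
      _ ≤ W i l := (hW i l).1
  have hr' : ∀ i, 0 < (W *ᵥ r) i := fun i =>
    Finset.sum_pos (fun l _ => mul_pos (hα.trans_le (hW i l).1) (hr l)) ⟨i, Finset.mem_univ i⟩
  have quot : ∀ (x : ι → ℝ), (∀ l, 0 ≤ x l) → ∀ i i',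
      (α / β) ^ 2 * ((W *ᵥ x) i' / (W *ᵥ r) i') ≤ (W *ᵥ x) i / (W *ᵥ r) i := by
    intro x hx i i'
    have h1 := compare x hx i i'
    have h2 := compare r (fun l => (hr l).le) i' i
    have hx' : 0 ≤ (W *ᵥ x) i' := Finset.sum_nonneg fun l _ =>
      mul_nonneg (hα.le.trans (hW i' l).1) (hx l)
    have hk : 0 < α / β := div_pos hα hβ
    rw [← mul_div_assoc, div_le_div_iff₀ (hr' i') (hr' i)]
    calc (α / β) ^ 2 * (W *ᵥ x) i' * (W *ᵥ r) i
        = (α / β * (W *ᵥ x) i') * (α / β * (W *ᵥ r) i) := by ring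
      _ ≤ (W *ᵥ x) i * (W *ᵥ r) i' := by
        refine mul_le_mul h1 h2 (mul_nonneg hk.le (hr' i).le) ((mul_nonneg hk.le hx').trans h1)
  have h1 := quot (y - lo • r) (fun l => by simpa using hlo l) b a
  have h2 := quot (hi • r - y) (fun l => by simpa using hhi l) a b
  simp only [Matrix.mulVec_sub, Matrix.mulVec_smul, Pi.sub_apply, Pi.smul_apply, smul_eq_mul,
    sub_div, mul_div_cancel_right₀ _ (hr' _).ne'] at h1 h2
  set fa := (W *ᵥ y) a / (W *ᵥ r) a
  set fb := (W *ᵥ y) b / (W *ᵥ r) b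
  have hk : 0 < (α / β) ^ 2 := by positivity
  rcases le_total fa fb with h | h
  · have hab : lo ≤ hi := le_of_mul_le_mul_right ((hlo a).trans (hhi a)) (hr a)
    have h3 : (α / β) ^ 2 ≤ 1 := by
      have : α ≤ β := (hW a a).1.trans (hW a a).2
      exact pow_le_one₀ (by positivity) ((div_le_one hβ).2 this)
    nlinarith [mul_nonneg (sub_nonneg.2 h3) (sub_nonneg.2 hab)]
  · nlinarith [mul_nonneg hk.le (sub_nonneg.2 h)]

section PositiveProducts

variable {ι : Type*} [Fintype ι] [DecidableEq ι]

/-- The product `B (s + m - 1) * ⋯ * B s` of `m` consecutive matrices of a sequence. -/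
def leftProd (B : ℕ → Matrix ι ι ℝ) (s : ℕ) : ℕ → Matrix ι ι ℝ
  | 0 => 1
  | m + 1 => B (s + m) * leftProd B s m

theorem leftProd_add (B : ℕ → Matrix ι ι ℝ) (k m : ℕ) :
    leftProd B 0 (k + m) = leftProd B k m * leftProd B 0 k := by
  induction m with
  | zero => simp [leftProd]
  | succ m ih => rw [← add_assoc, leftProd, ih, leftProd, Matrix.mul_assoc, Nat.zero_add]

theorem pow_nonneg_apply {A : Matrix ι ι ℝ} (hA : ∀ i j, 0 ≤ A i j) (m : ℕ) (i j : ι) :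
    0 ≤ (A ^ m) i j := by
  induction m generalizing i j with
  | zero => rw [pow_zero, Matrix.one_apply]; split_ifs <;> norm_num
  | succ m ih =>
    rw [pow_succ, Matrix.mul_apply]
    exact Finset.sum_nonneg fun l _ => mul_nonneg (ih _ _) (hA _ _)

theorem exists_pow_pos {A : Matrix ι ι ℝ} (hA : ∀ i j, 0 ≤ A i j) (hdiag : ∀ i, 0 < A i i)
    {E : ι → ι → Prop} (hE : ∀ i j, E i j → 0 < A i j)
    (hconn : ∀ i j, Relation.ReflTransGen E i j) :
    ∃ L : ℕ, 0 < L ∧ ∀ i j, 0 < (A ^ L) i j := by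
  have mul_step : ∀ (k : ℕ) (i b j : ι), 0 < (A ^ k) i b → 0 < A b j →
      0 < (A ^ (k + 1)) i j := by
    intro k i b j h1 h2
    rw [pow_succ, Matrix.mul_apply]
    exact (mul_pos h1 h2).trans_le (Finset.single_le_sum
      (f := fun l => (A ^ k) i l * A l j)
      (fun l _ => mul_nonneg (pow_nonneg_apply hA _ _ _) (hA _ _)) (Finset.mem_univ b))
  have key : ∀ i j, ∃ N : ℕ, ∀ k, N ≤ k → 0 < (A ^ k) i j := by
    intro i j
    induction hconn i j with
    | refl =>
      refine ⟨0, fun k hk => ?_⟩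
      clear hk
      induction k with
      | zero => simp
      | succ k ih => exact mul_step k i i i ih (hdiag i)
    | tail _ hbc ih =>
      obtain ⟨N, hN⟩ := ih
      refine ⟨N + 1, fun k hk => ?_⟩
      obtain ⟨k, rfl⟩ : ∃ k', k = k' + 1 := ⟨k - 1, by omega⟩
      exact mul_step k _ _ _ (hN k (by omega)) (hE _ _ hbc)
  choose N hN using key
  refine ⟨(∑ i, ∑ j, N i j) + 1, Nat.succ_pos _, fun i j => hN i j _ ?_⟩
  calc N i j ≤ ∑ j, N i j :=
        Finset.single_le_sum (f := fun j => N i j) (fun _ _ => Nat.zero_le _) (Finset.mem_univ j)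
    _ ≤ ∑ i, ∑ j, N i j :=
        Finset.single_le_sum (f := fun i => ∑ j, N i j) (fun _ _ => Nat.zero_le _)
          (Finset.mem_univ i)
    _ ≤ _ := Nat.le_succ _

/-- The sequence `B` is entrywise comparable to the fixed matrix `A`. -/
def EntrywiseComparable (A : Matrix ι ι ℝ) (c C : ℝ) (B : ℕ → Matrix ι ι ℝ) : Prop :=
  ∀ k i j, c * A i j ≤ B k i j ∧ B k i j ≤ C * A i j

theorem leftProd_bounds {A : Matrix ι ι ℝ} (hA : ∀ i j, 0 ≤ A i j) {c C : ℝ} (hc : 0 ≤ c)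
    (hC : 0 ≤ C) {B : ℕ → Matrix ι ι ℝ} (hB : EntrywiseComparable A c C B)
    (s m : ℕ) (i j : ι) :
    c ^ m * (A ^ m) i j ≤ leftProd B s m i j ∧
      leftProd B s m i j ≤ C ^ m * (A ^ m) i j := by
  induction m generalizing i j with
  | zero => simp [leftProd]
  | succ m ih =>
    have hW : ∀ l, 0 ≤ leftProd B s m l j := fun l =>
      (mul_nonneg (pow_nonneg hc m) (pow_nonneg_apply hA m l j)).trans (ih l j).1
    rw [leftProd, pow_succ' A, Matrix.mul_apply, Matrix.mul_apply, Finset.mul_sum,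
      Finset.mul_sum]
    constructor <;> refine Finset.sum_le_sum fun l _ => ?_
    · calc c ^ (m + 1) * (A i l * (A ^ m) l j)
          = (c * A i l) * (c ^ m * (A ^ m) l j) := by ring
        _ ≤ (c * A i l) * leftProd B s m l j :=
          mul_le_mul_of_nonneg_left (ih l j).1 (mul_nonneg hc (hA i l))
        _ ≤ _ := mul_le_mul_of_nonneg_right (hB _ i l).1 (hW l)
    · calc B (s + m) i l * leftProd B s m l j
          ≤ (C * A i l) * leftProd B s m l j :=
          mul_le_mul_of_nonneg_right (hB _ i l).2 (hW l)
        _ ≤ (C * A i l) * (C ^ m * (A ^ m) l j) :=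
          mul_le_mul_of_nonneg_left (ih l j).2 (mul_nonneg hC (hA i l))
        _ = _ := by ring

end PositiveProducts

theorem le_geometric_of_block_contraction {D : ℕ → ℝ} {ρ : ℝ} (hρ0 : 0 < ρ) (hρ1 : ρ < 1)
    {L : ℕ} (hL : 0 < L) (hD : ∀ k, D k ≤ 1) (hstep : ∀ k, D (k + L) ≤ ρ * D k) (k : ℕ) :
    D k ≤ ρ⁻¹ * (ρ ^ ((L : ℝ)⁻¹)) ^ k := by
  set q : ℝ := ρ ^ ((L : ℝ)⁻¹) with hq
  have hq0 : 0 < q := Real.rpow_pos_of_pos hρ0 _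
  have hq1 : q ≤ 1 := Real.rpow_le_one hρ0.le hρ1.le (by positivity)
  have hqL : q ^ L = ρ := Real.rpow_inv_natCast_pow hρ0.le hL.ne'
  induction k using Nat.strong_induction_on with
  | _ k ih =>
    rcases lt_or_ge k L with h | h
    · refine (hD k).trans ?_
      have : ρ ≤ q ^ k := hqL ▸ pow_le_pow_of_le_one hq0.le hq1 h.le
      rwa [inv_mul_eq_div, one_le_div hρ0]
    · obtain ⟨m, rfl⟩ : ∃ m, k = m + L := ⟨k - L, by omega⟩
      calc D (m + L) ≤ ρ * D m := hstep m
        _ ≤ ρ * (ρ⁻¹ * q ^ m) := by gcongr; exact ih m (by omega)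
        _ = ρ⁻¹ * q ^ (m + L) := by rw [pow_add, hqL]; ring

section QuotientLimits

variable {ι : Type*} [Fintype ι] [DecidableEq ι]

theorem leftProd_nonneg {B : ℕ → Matrix ι ι ℝ} (hB : ∀ k i j, 0 ≤ B k i j) (s m : ℕ) (i j : ι) :
    0 ≤ leftProd B s m i j := by
  induction m generalizing i j with
  | zero => rw [leftProd, Matrix.one_apply]; split_ifs <;> norm_num
  | succ m ih =>
    rw [leftProd, Matrix.mul_apply]
    exact Finset.sum_nonneg fun l _ => mul_nonneg (hB _ _ _) (ih _ _)

theorem leftProd_rowSum_pos {B : ℕ → Matrix ι ι ℝ} (hB : ∀ k i j, 0 ≤ B k i j)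
    (hdiag : ∀ k i, 0 < B k i i) (k : ℕ) (i : ι) : 0 < (leftProd B 0 k *ᵥ 1) i := by
  induction k generalizing i with
  | zero => simp [leftProd]
  | succ k ih =>
    rw [leftProd, ← Matrix.mulVec_mulVec, Nat.zero_add]
    exact (mul_pos (hdiag k i) (ih i)).trans_le (Finset.single_le_sum
      (f := fun l => B k i l * (leftProd B 0 k *ᵥ 1) l)
      (fun l _ => mul_nonneg (hB k i l) (ih l).le) (Finset.mem_univ i))

/-- Quotients of the products applied to `x` and to the constant vector converge to a common
limit, at a geometric rate which depends only on the bounds for blocks of length `L`. -/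
theorem exists_quotient_limit [Nonempty ι] {B : ℕ → Matrix ι ι ℝ} (hB : ∀ k i j, 0 ≤ B k i j)
    (hdiag : ∀ k i, 0 < B k i i) {α β : ℝ} (hα : 0 < α) (hβ : 0 < β) {L : ℕ} (hL : 0 < L)
    (hblock : ∀ s i j, α ≤ leftProd B s L i j ∧ leftProd B s L i j ≤ β)
    {ρ : ℝ} (hρ0 : 0 < ρ) (hρ1 : ρ < 1) (hρ : 1 - (α / β) ^ 2 ≤ ρ)
    {x : ι → ℝ} (hx0 : ∀ i, 0 ≤ x i) (hx1 : ∀ i, x i ≤ 1) :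
    ∃ v : ℝ, (∀ k i, |(leftProd B 0 k *ᵥ x) i / (leftProd B 0 k *ᵥ 1) i - v| ≤
        ρ⁻¹ * (ρ ^ ((L : ℝ)⁻¹)) ^ k) ∧
      ((∀ i, 0 < (leftProd B 0 L *ᵥ x) i) → 0 < v) := by
  set f : ℕ → ι → ℝ := fun k i => (leftProd B 0 k *ᵥ x) i / (leftProd B 0 k *ᵥ 1) i with hf
  have hr := leftProd_rowSum_pos hB hdiag
  have hlo : ∀ k i, (⨅ a, f k a) ≤ f k i := fun k i => ciInf_le (Set.finite_range _).bddBelow i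
  have hhi : ∀ k i, f k i ≤ ⨆ a, f k a := fun k i => le_ciSup (Set.finite_range _).bddAbove i
  have hlo' : ∀ k i, (⨅ a, f k a) * (leftProd B 0 k *ᵥ 1) i ≤ (leftProd B 0 k *ᵥ x) i :=
    fun k i => (le_div_iff₀ (hr k i)).1 (hlo k i)
  have hhi' : ∀ k i, (leftProd B 0 k *ᵥ x) i ≤ (⨆ a, f k a) * (leftProd B 0 k *ᵥ 1) i :=
    fun k i => (div_le_iff₀ (hr k i)).1 (hhi k i)
  have mono : ∀ (W : Matrix ι ι ℝ), (∀ i j, 0 ≤ W i j) → ∀ y z : ι → ℝ, (∀ i, y i ≤ z i) →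
      ∀ i, (W *ᵥ y) i ≤ (W *ᵥ z) i := fun W hW y z hyz i =>
    Finset.sum_le_sum fun l _ => mul_le_mul_of_nonneg_left (hyz l) (hW i l)
  have hsucc : ∀ k (z : ι → ℝ), leftProd B 0 (k + 1) *ᵥ z = B k *ᵥ (leftProd B 0 k *ᵥ z) := by
    intro k z
    rw [leftProd, ← Matrix.mulVec_mulVec, Nat.zero_add]
  have hmono : Monotone fun k => ⨅ a, f k a := by
    refine monotone_nat_of_le_succ fun k => le_ciInf fun i => ?_
    rw [hf, le_div_iff₀ (hr _ i), hsucc, hsucc]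
    have := mono (B k) (hB k) ((⨅ a, f k a) • (leftProd B 0 k *ᵥ 1)) _ (hlo' k) i
    rwa [Matrix.mulVec_smul] at this
  have hanti : Antitone fun k => ⨆ a, f k a := by
    refine antitone_nat_of_succ_le fun k => ciSup_le fun i => ?_
    rw [hf, div_le_iff₀ (hr _ i), hsucc, hsucc]
    have := mono (B k) (hB k) _ ((⨆ a, f k a) • (leftProd B 0 k *ᵥ 1)) (hhi' k) i
    rwa [Matrix.mulVec_smul] at this
  have hle : ∀ k, (⨅ a, f k a) ≤ ⨆ a, f k a := fun k =>
    (hlo k (Classical.arbitrary ι)).trans (hhi k _)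
  have hosc : ∀ k, (⨆ a, f k a) - (⨅ a, f k a) ≤ ρ⁻¹ * (ρ ^ ((L : ℝ)⁻¹)) ^ k := by
    refine le_geometric_of_block_contraction
      (D := fun k => (⨆ a, f k a) - (⨅ a, f k a)) hρ0 hρ1 hL (fun k => ?_) (fun k => ?_)
    · have h0 : 0 ≤ ⨅ a, f k a := le_ciInf fun i => div_nonneg
        (Finset.sum_nonneg fun l _ => mul_nonneg (leftProd_nonneg hB 0 k i l) (hx0 l)) (hr k i).le
      have h1 : (⨆ a, f k a) ≤ 1 := ciSup_le fun i =>
        (div_le_one (hr k i)).2 (mono _ (leftProd_nonneg hB 0 k) x 1 hx1 i)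
      linarith
    · obtain ⟨a, ha⟩ := exists_eq_ciSup_of_finite (f := f (k + L))
      obtain ⟨b, hb⟩ := exists_eq_ciInf_of_finite (f := f (k + L))
      have h := quotient_osc_contract hα hβ (hblock k) (hr k) (hlo' k) (hhi' k) a b
      rw [Matrix.mulVec_mulVec, Matrix.mulVec_mulVec, ← leftProd_add] at h
      change _ ≤ ρ * ((⨆ a, f k a) - (⨅ a, f k a))
      rw [← ha, ← hb]
      exact h.trans (mul_le_mul_of_nonneg_right hρ (sub_nonneg.2 (hle k)))
  have hmem := hmono.ciSup_mem_iInter_Icc_of_antitone hanti hle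
  rw [Set.mem_iInter] at hmem
  refine ⟨⨆ k, ⨅ a, f k a, fun k i => ?_, fun hpos => ?_⟩
  · exact (abs_sub_le_of_le_of_le (hlo k i) (hhi k i) (hmem k).1 (hmem k).2).trans (hosc k)
  · obtain ⟨b, hb⟩ := exists_eq_ciInf_of_finite (f := f L)
    have : 0 < f L b := div_pos (hpos b) (hr L b)
    exact (hb ▸ this).trans_le (hmem L).1

/-- Row-sum normalized products of matrices comparable to a matrix with a positive power converge
geometrically to a matrix with equal positive rows, at a rate independent of the sequence. -/
theorem exists_uniform_rowSum_limit [Nonempty ι] {A : Matrix ι ι ℝ} (hA : ∀ i j, 0 ≤ A i j)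
    (hdiag : ∀ i, 0 < A i i) {L : ℕ} (hL : 0 < L) (hpow : ∀ i j, 0 < (A ^ L) i j)
    {c C : ℝ} (hc : 0 < c) (hC : 0 < C) :
    ∃ K q : ℝ, 0 < K ∧ 0 < q ∧ q < 1 ∧ ∀ B : ℕ → Matrix ι ι ℝ, EntrywiseComparable A c C B →
      ∃ v : ι → ℝ, (∀ j, 0 < v j) ∧ ∀ k i j,
        |leftProd B 0 k i j / (leftProd B 0 k *ᵥ 1) i - v j| ≤ K * q ^ k := by
  obtain ⟨a, ha⟩ := Finite.exists_min fun p : ι × ι => (A ^ L) p.1 p.2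
  obtain ⟨b, hb⟩ := Finite.exists_max fun p : ι × ι => (A ^ L) p.1 p.2
  set α := c ^ L * (A ^ L) a.1 a.2
  set β := C ^ L * (A ^ L) b.1 b.2
  have hα : 0 < α := mul_pos (pow_pos hc L) (hpow _ _)
  have hβ : 0 < β := mul_pos (pow_pos hC L) (hpow _ _)
  obtain ⟨ρ, hρ, hρ1⟩ : ∃ ρ, max (1 - (α / β) ^ 2) 0 < ρ ∧ ρ < 1 :=
    exists_between (max_lt (by have : 0 < (α / β) ^ 2 := by positivity
                               linarith) one_pos)
  have hρ0 : 0 < ρ := (le_max_right _ _).trans_lt hρ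
  refine ⟨ρ⁻¹, ρ ^ ((L : ℝ)⁻¹), inv_pos.2 hρ0, Real.rpow_pos_of_pos hρ0 _,
    Real.rpow_lt_one hρ0.le hρ1 (by positivity), fun B hB => ?_⟩
  have hBnn : ∀ k i j, 0 ≤ B k i j := fun k i j =>
    (mul_nonneg hc.le (hA i j)).trans (hB k i j).1
  have hBd : ∀ k i, 0 < B k i i := fun k i => (mul_pos hc (hdiag i)).trans_le (hB k i i).1
  have hblock : ∀ s i j, α ≤ leftProd B s L i j ∧ leftProd B s L i j ≤ β := by
    intro s i j
    have h := leftProd_bounds hA hc.le hC.le hB s L i j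
    exact ⟨(mul_le_mul_of_nonneg_left (ha (i, j)) (pow_nonneg hc.le L)).trans h.1,
      h.2.trans (mul_le_mul_of_nonneg_left (hb (i, j)) (pow_nonneg hC.le L))⟩
  have hcol : ∀ j : ι, ∃ v : ℝ,
      (∀ k i, |leftProd B 0 k i j / (leftProd B 0 k *ᵥ 1) i - v| ≤
        ρ⁻¹ * (ρ ^ ((L : ℝ)⁻¹)) ^ k) ∧ 0 < v := by
    intro j
    obtain ⟨v, hv, hpos⟩ := exists_quotient_limit hBnn hBd hα hβ hL hblock hρ0 hρ1
      ((le_max_left _ _).trans hρ.le) (x := Pi.single j 1)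
      (fun i => by rw [Pi.single_apply]; split_ifs <;> norm_num)
      (fun i => by rw [Pi.single_apply]; split_ifs <;> norm_num)
    simp only [Matrix.mulVec_single_one, Matrix.col_apply] at hv hpos
    exact ⟨v, hv, hpos fun i => hα.trans_le (hblock 0 i j).1⟩
  choose v hv hv0 using hcol
  exact ⟨v, hv0, fun k i j => hv j k i⟩

end QuotientLimits

section EuclideanNormalization

theorem euclNorm_eq_norm {d : ℕ} (x : Fin d → ℝ) : euclNorm x = ‖WithLp.toLp 2 x‖ := by
  simp [euclNorm, EuclideanSpace.norm_eq]

theorem euclNorm_smul {d : ℕ} (a : ℝ) (x : Fin d → ℝ) : euclNorm (a • x) = |a| * euclNorm x := by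
  rw [euclNorm_eq_norm, euclNorm_eq_norm, WithLp.toLp_smul, norm_smul, Real.norm_eq_abs]

theorem euclNorm_add_le {d : ℕ} (x y : Fin d → ℝ) :
    euclNorm (x + y) ≤ euclNorm x + euclNorm y := by
  simp only [euclNorm_eq_norm, WithLp.toLp_add]
  exact norm_add_le _ _

theorem abs_euclNorm_sub_euclNorm_le {d : ℕ} (x y : Fin d → ℝ) :
    |euclNorm x - euclNorm y| ≤ euclNorm (x - y) := by
  simp only [euclNorm_eq_norm, WithLp.toLp_sub]
  exact abs_norm_sub_norm_le _ _

theorem euclNorm_sum_le {d : ℕ} {κ : Type*} (s : Finset κ) (x : κ → Fin d → ℝ) :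
    euclNorm (∑ j ∈ s, x j) ≤ ∑ j ∈ s, euclNorm (x j) := by
  simp only [euclNorm_eq_norm, WithLp.toLp_sum]
  exact norm_sum_le _ _

theorem abs_apply_le_euclNorm {d : ℕ} (x : Fin d → ℝ) (j : Fin d) : |x j| ≤ euclNorm x := by
  rw [euclNorm_eq_norm]
  exact PiLp.norm_apply_le (WithLp.toLp 2 x) j

theorem euclNorm_normalize {d : ℕ} {x : Fin d → ℝ} (hx : 0 < euclNorm x) :
    euclNorm ((euclNorm x)⁻¹ • x) = 1 := by
  rw [euclNorm_smul, abs_of_pos (inv_pos.2 hx), inv_mul_cancel₀ hx.ne']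

theorem normalize_smul_of_pos {d : ℕ} {a : ℝ} (ha : 0 < a) (x : Fin d → ℝ) :
    (euclNorm (a • x))⁻¹ • (a • x) = (euclNorm x)⁻¹ • x := by
  rw [euclNorm_smul, abs_of_pos ha, smul_smul, mul_inv]
  congr 1
  field_simp

theorem euclNorm_normalize_sub_normalize_le {d : ℕ} {x y : Fin d → ℝ} (hx : 0 < euclNorm x)
    (hy : 0 < euclNorm y) :
    euclNorm ((euclNorm x)⁻¹ • x - (euclNorm y)⁻¹ • y) ≤ 2 * euclNorm (x - y) / euclNorm y := by
  have hsplit : (euclNorm x)⁻¹ • x - (euclNorm y)⁻¹ • y =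
      (euclNorm y)⁻¹ • (x - y) + ((euclNorm x)⁻¹ - (euclNorm y)⁻¹) • x := by
    module
  have hcoef : |(euclNorm x)⁻¹ - (euclNorm y)⁻¹| * euclNorm x =
      |euclNorm y - euclNorm x| / euclNorm y := by
    rw [inv_sub_inv hx.ne' hy.ne', abs_div, abs_of_pos (mul_pos hx hy)]
    field_simp
  rw [hsplit]
  refine (euclNorm_add_le _ _).trans ?_
  rw [euclNorm_smul, euclNorm_smul, hcoef, abs_of_pos (inv_pos.2 hy), abs_sub_comm,
    inv_mul_eq_div, ← add_div]
  gcongr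
  linarith [abs_euclNorm_sub_euclNorm_le x y]

theorem euclNorm_le_sqrt_mul {d : ℕ} {x : Fin d → ℝ} {ε : ℝ} (hε : 0 ≤ ε)
    (hx : ∀ j, |x j| ≤ ε) : euclNorm x ≤ √d * ε := by
  rw [euclNorm, ← Real.sqrt_sq hε, ← Real.sqrt_mul (Nat.cast_nonneg d)]
  refine Real.sqrt_le_sqrt ?_
  calc ∑ j, x j ^ 2 ≤ ∑ _j : Fin d, ε ^ 2 :=
        Finset.sum_le_sum fun j _ => sq_le_sq' (abs_le.1 (hx j)).1 (abs_le.1 (hx j)).2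
    _ = d * ε ^ 2 := by simp

theorem one_le_sqrt_mul_euclNorm {d : ℕ} {x : Fin d → ℝ} (hx : ∑ j, x j = 1) :
    1 ≤ √d * euclNorm x := by
  rw [euclNorm, ← Real.sqrt_mul (Nat.cast_nonneg d), Real.one_le_sqrt]
  simpa [hx] using sq_sum_le_card_mul_sum_sq (s := Finset.univ) (f := x)

theorem euclNorm_normalize_sub_le_of_sum_eq_one {d : ℕ} {x y : Fin d → ℝ} (hx : ∑ j, x j = 1)
    (hy : ∑ j, y j = 1) {ε : ℝ} (hε : 0 ≤ ε) (hxy : ∀ j, |x j - y j| ≤ ε) :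
    euclNorm ((euclNorm x)⁻¹ • x - (euclNorm y)⁻¹ • y) ≤ 2 * d * ε := by
  have pos : ∀ z : Fin d → ℝ, ∑ j, z j = 1 → 0 < euclNorm z := fun z hz =>
    pos_of_mul_pos_right (one_pos.trans_le (one_le_sqrt_mul_euclNorm hz)) (Real.sqrt_nonneg _)
  refine (euclNorm_normalize_sub_normalize_le (pos x hx) (pos y hy)).trans ?_
  rw [div_le_iff₀ (pos y hy)]
  have h1 : euclNorm (x - y) ≤ √d * ε := euclNorm_le_sqrt_mul hε hxy
  calc 2 * euclNorm (x - y) ≤ 2 * (√d * ε) := by gcongr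
    _ = 2 * (√d * ε) * 1 := by ring
    _ ≤ 2 * (√d * ε) * (√d * euclNorm y) := by
      gcongr
      exact one_le_sqrt_mul_euclNorm hy
    _ = 2 * (√d * √d) * ε * euclNorm y := by ring
    _ = 2 * d * ε * euclNorm y := by rw [Real.mul_self_sqrt (Nat.cast_nonneg d)]

end EuclideanNormalization

section Trajectory

variable {n d : ℕ}

theorem unitSphere_nonempty (hd : 1 ≤ d) : (unitSphere d).Nonempty := by
  refine ⟨Pi.single ⟨0, hd⟩ 1, ?_⟩
  simp [unitSphere, euclNorm, Pi.single_apply]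

theorem IsDirectional.sInf_pos (hd : 1 ≤ d) {γ : (Fin d → ℝ) → ℝ} (hγ : IsDirectional γ) :
    0 < sInf (γ '' unitSphere d) := by
  obtain ⟨-, c, C, hc, h⟩ := hγ
  refine hc.trans_le (le_csInf ((unitSphere_nonempty hd).image γ) ?_)
  rintro _ ⟨x, hx, rfl⟩
  exact (h x hx).1

theorem IsDirectional.sInf_le_and_le_sSup {γ : (Fin d → ℝ) → ℝ} (hγ : IsDirectional γ)
    {x : Fin d → ℝ} (hx : x ∈ unitSphere d) :
    sInf (γ '' unitSphere d) ≤ γ x ∧ γ x ≤ sSup (γ '' unitSphere d) := by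
  obtain ⟨-, c, C, hc, h⟩ := hγ
  constructor
  · refine csInf_le ⟨c, ?_⟩ ⟨x, hx, rfl⟩
    rintro _ ⟨x, hx, rfl⟩
    exact (h x hx).1
  · refine le_csSup ⟨C, ?_⟩ ⟨x, hx, rfl⟩
    rintro _ ⟨x, hx, rfl⟩
    exact (h x hx).2

theorem IsDirectional.sInf_le_sSup (hd : 1 ≤ d) {γ : (Fin d → ℝ) → ℝ} (hγ : IsDirectional γ) :
    sInf (γ '' unitSphere d) ≤ sSup (γ '' unitSphere d) := by
  obtain ⟨x, hx⟩ := unitSphere_nonempty hd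
  exact (hγ.sInf_le_and_le_sSup hx).1.trans (hγ.sInf_le_and_le_sSup hx).2

theorem IsDirectional.euclNorm_mem_Icc (hd : 1 ≤ d) {γ : (Fin d → ℝ) → ℝ}
    (hγ : IsDirectional γ) {y : Fin d → ℝ} (hy : y ∈ starBoundary γ) :
    sInf (γ '' unitSphere d) ≤ euclNorm y ∧ euclNorm y ≤ sSup (γ '' unitSphere d) := by
  obtain ⟨x, hx, rfl⟩ := hy
  have h := hγ.sInf_le_and_le_sSup hx
  have hx1 : euclNorm x = 1 := hx
  rwa [euclNorm_smul, hx1, mul_one, abs_of_pos ((hγ.sInf_pos hd).trans_le h.1)]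

theorem Assumption2.nonneg {A : Matrix (Fin n) (Fin n) ℝ} {γbar : Fin n → (Fin d → ℝ) → ℝ}
    (hA : Assumption2 A γbar) (i j : Fin n) : 0 ≤ A i j := by
  obtain ⟨-, ⟨E, hE, hE', -⟩, -⟩ := hA
  by_cases h : E i j
  · exact (hE i j h).le
  · exact (hE' i j h).ge

theorem Assumption2.diag_pos (hd : 1 ≤ d) {A : Matrix (Fin n) (Fin n) ℝ}
    {γbar : Fin n → (Fin d → ℝ) → ℝ} (hA : Assumption2 A γbar) (i : Fin n) : 0 < A i i := by
  have h0 : 0 ≤ ∑ j ∈ Finset.univ.erase i, A i j * sSup (γbar j '' unitSphere d) :=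
    Finset.sum_nonneg fun j _ => mul_nonneg (hA.nonneg i j)
      (((hA.1 j).sInf_pos hd).le.trans ((hA.1 j).sInf_le_sSup hd))
  exact pos_of_mul_pos_left (h0.trans_lt (hA.2.2 i)) ((hA.1 i).sInf_pos hd).le

theorem mul_row_eq_sum (A : Matrix (Fin n) (Fin n) ℝ) (X : Matrix (Fin n) (Fin d) ℝ)
    (i : Fin n) : (A * X) i = ∑ j, A i j • X j := by
  ext l
  simp [Matrix.mul_apply]

theorem Assumption2.euclNorm_mul_row_bounds (hd : 1 ≤ d) {A : Matrix (Fin n) (Fin n) ℝ}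
    {γbar : Fin n → (Fin d → ℝ) → ℝ} (hA : Assumption2 A γbar)
    {X : Matrix (Fin n) (Fin d) ℝ} (hX : X ∈ Sset n d γbar) (i : Fin n) :
    A i i * sInf (γbar i '' unitSphere d) -
        ∑ j ∈ Finset.univ.erase i, A i j * sSup (γbar j '' unitSphere d) ≤
          euclNorm ((A * X) i) ∧
      euclNorm ((A * X) i) ≤ ∑ j, A i j * sSup (γbar j '' unitSphere d) := by
  have hnorm : ∀ j, euclNorm (A i j • X j) = A i j * euclNorm (X j) := fun j => by
    rw [euclNorm_smul, abs_of_nonneg (hA.nonneg i j)]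
  have hX' := fun j => (hA.1 j).euclNorm_mem_Icc hd (hX j)
  have hsum : ∀ s : Finset (Fin n), euclNorm (∑ j ∈ s, A i j • X j) ≤
      ∑ j ∈ s, A i j * sSup (γbar j '' unitSphere d) := fun s =>
    (euclNorm_sum_le s _).trans (Finset.sum_le_sum fun j _ => (hnorm j).trans_le
      (mul_le_mul_of_nonneg_left (hX' j).2 (hA.nonneg i j)))
  rw [mul_row_eq_sum]
  refine ⟨?_, hsum _⟩
  have h1 := abs_euclNorm_sub_euclNorm_le (A i i • X i) (∑ j, A i j • X j)
  rw [← Finset.add_sum_erase _ _ (Finset.mem_univ i), sub_add_cancel_left] at h1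
  rw [← Finset.add_sum_erase _ _ (Finset.mem_univ i)]
  have h2 : euclNorm (-∑ j ∈ Finset.univ.erase i, A i j • X j) =
      euclNorm (∑ j ∈ Finset.univ.erase i, A i j • X j) := by
    rw [← neg_one_smul ℝ, euclNorm_smul]
    simp
  have h3 := mul_le_mul_of_nonneg_left (hX' i).1 (hA.nonneg i i)
  have h4 := hsum (Finset.univ.erase i)
  have h5 := (le_abs_self _).trans h1
  rw [hnorm] at h5
  linarith

theorem Assumption2.euclNorm_mul_row_pos (hd : 1 ≤ d) {A : Matrix (Fin n) (Fin n) ℝ}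
    {γbar : Fin n → (Fin d → ℝ) → ℝ} (hA : Assumption2 A γbar)
    {X : Matrix (Fin n) (Fin d) ℝ} (hX : X ∈ Sset n d γbar) (i : Fin n) :
    0 < euclNorm ((A * X) i) :=
  (sub_pos.2 (hA.2.2 i)).trans_le (hA.euclNorm_mul_row_bounds hd hX i).1

theorem Assumption2.traj_mem_Sset (hd : 1 ≤ d) {A : Matrix (Fin n) (Fin n) ℝ}
    {γbar : Fin n → (Fin d → ℝ) → ℝ} (hA : Assumption2 A γbar)
    {X₀ : Matrix (Fin n) (Fin d) ℝ} (hX : X₀ ∈ Sset n d γbar) (k : ℕ) :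
    traj A γbar X₀ k ∈ Sset n d γbar := by
  induction k with
  | zero => exact hX
  | succ k ih =>
    exact fun i => ⟨_, euclNorm_normalize (hA.euclNorm_mul_row_pos hd ih i), rfl⟩

theorem Assumption2.exists_Dmat_bounds (hn : 1 ≤ n) (hd : 1 ≤ d)
    {A : Matrix (Fin n) (Fin n) ℝ} {γbar : Fin n → (Fin d → ℝ) → ℝ} (hA : Assumption2 A γbar) :
    ∃ c C : ℝ, 0 < c ∧ 0 < C ∧ ∀ X ∈ Sset n d γbar, ∀ i,
      c ≤ Dmat γbar (A * X) i i ∧ Dmat γbar (A * X) i i ≤ C := by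
  have : Nonempty (Fin n) := ⟨⟨0, hn⟩⟩
  set m : Fin n → ℝ := fun i => sInf (γbar i '' unitSphere d)
  set M : Fin n → ℝ := fun i => sSup (γbar i '' unitSphere d)
  set δ : Fin n → ℝ := fun i => A i i * m i - ∑ j ∈ Finset.univ.erase i, A i j * M j
  set R : Fin n → ℝ := fun i => ∑ j, A i j * M j
  have hm : ∀ i, 0 < m i := fun i => (hA.1 i).sInf_pos hd
  have hM : ∀ i, 0 < M i := fun i => (hm i).trans_le ((hA.1 i).sInf_le_sSup hd)
  have hδ : ∀ i, 0 < δ i := fun i => sub_pos.2 (hA.2.2 i)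
  have hR : ∀ i, 0 < R i := fun i => (mul_pos (hA.diag_pos hd i) (hM i)).trans_le
    (Finset.single_le_sum (f := fun j => A i j * M j)
      (fun j _ => mul_nonneg (hA.nonneg i j) (hM j).le) (Finset.mem_univ i))
  obtain ⟨a, ha⟩ := Finite.exists_min fun i => m i / R i
  obtain ⟨b, hb⟩ := Finite.exists_max fun i => M i / δ i
  refine ⟨m a / R a, M b / δ b, div_pos (hm a) (hR a), div_pos (hM b) (hδ b),
    fun X hX i => ?_⟩
  have hpos := hA.euclNorm_mul_row_pos hd hX i
  have hnorm := hA.euclNorm_mul_row_bounds hd hX i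
  have hγ := (hA.1 i).sInf_le_and_le_sSup (euclNorm_normalize hpos)
  rw [Dmat, Matrix.diagonal_apply_eq]
  exact ⟨(ha i).trans (div_le_div₀ ((hm i).le.trans hγ.1) hγ.1 hpos hnorm.2),
    (div_le_div₀ (hM i).le hγ.2 (hδ i) hnorm.1).trans (hb i)⟩

theorem Atilde_eq_leftProd (A : Matrix (Fin n) (Fin n) ℝ) (γbar : Fin n → (Fin d → ℝ) → ℝ)
    (X₀ : Matrix (Fin n) (Fin d) ℝ) (k : ℕ) :
    Atilde A γbar X₀ k = leftProd (fun k => Dmat γbar (A * traj A γbar X₀ k) * A) 0 k := by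
  induction k with
  | zero => rfl
  | succ k ih => rw [Atilde, leftProd, ih, Nat.zero_add]

end Trajectory

theorem stmt9 {n d : ℕ} (hn : 1 ≤ n) (hd : 1 ≤ d)
    (A : Matrix (Fin n) (Fin n) ℝ) (γbar : Fin n → (Fin d → ℝ) → ℝ)
    (hA : Assumption2 A γbar) :
    ∃ C q : ℝ, 0 < C ∧ 0 < q ∧ q < 1 ∧
      ∀ X₀ ∈ Sset n d γbar, ∃ v : Fin n → ℝ,
        euclNorm v = 1 ∧ (∀ i, 0 < v i) ∧
        (∀ i, Tendsto (fun k => (euclNorm (Atilde A γbar X₀ k i))⁻¹ • Atilde A γbar X₀ k i)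
          atTop (𝓝 v)) ∧
        ∀ i : Fin n, ∀ k : ℕ, 1 ≤ k →
          euclNorm ((euclNorm (Atilde A γbar X₀ k i))⁻¹ • Atilde A γbar X₀ k i - v)
            ≤ C * q ^ k := by
  have : Nonempty (Fin n) := ⟨⟨0, hn⟩⟩
  have hdiag := hA.diag_pos hd
  obtain ⟨E, hE, -, hconn⟩ := hA.2.1
  obtain ⟨L, hL, hpow⟩ := exists_pow_pos hA.nonneg hdiag hE hconn
  obtain ⟨c, C, hc, hC, hD⟩ := hA.exists_Dmat_bounds hn hd
  obtain ⟨K, q, hK, hq0, hq1, hlim⟩ := exists_uniform_rowSum_limit hA.nonneg hdiag hL hpow hc hC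
  have hn0 : (0 : ℝ) < n := by exact_mod_cast hn
  refine ⟨2 * n * K, q, by positivity, hq0, hq1, fun X₀ hX₀ => ?_⟩
  set B : ℕ → Matrix (Fin n) (Fin n) ℝ := fun k => Dmat γbar (A * traj A γbar X₀ k) * A with hBdef
  have hB : EntrywiseComparable A c C B := by
    intro k i j
    have h := hD _ (hA.traj_mem_Sset hd hX₀ k) i
    have hBij : B k i j = Dmat γbar (A * traj A γbar X₀ k) i i * A i j := by
      simp [hBdef, Dmat, Matrix.diagonal_mul]
    rw [hBij]
    exact ⟨mul_le_mul_of_nonneg_right h.1 (hA.nonneg i j),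
      mul_le_mul_of_nonneg_right h.2 (hA.nonneg i j)⟩
  obtain ⟨w, hw0, hw⟩ := hlim B hB
  have hr : ∀ k i, 0 < (leftProd B 0 k *ᵥ 1) i := leftProd_rowSum_pos
    (fun k i j => (mul_nonneg hc.le (hA.nonneg i j)).trans (hB k i j).1)
    (fun k i => (mul_pos hc (hdiag i)).trans_le (hB k i i).1)
  set p : ℕ → Fin n → Fin n → ℝ := fun k i => ((leftProd B 0 k *ᵥ 1) i)⁻¹ • leftProd B 0 k i
  have hp : ∀ k i j, |p k i j - w j| ≤ K * q ^ k := fun k i j => by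
    simpa [p, div_eq_inv_mul] using hw k i j
  have hp1 : ∀ k i, ∑ j, p k i j = 1 := fun k i => by
    have h : (leftProd B 0 k *ᵥ 1) i = ∑ j, leftProd B 0 k i j := by
      simp [Matrix.mulVec, dotProduct]
    simp only [p, Pi.smul_apply, smul_eq_mul, ← Finset.mul_sum, ← h]
    exact inv_mul_cancel₀ (hr k i).ne'
  have hgeom : ∀ a : ℝ, Tendsto (fun k => a * q ^ k) atTop (𝓝 0) := fun a => by
    simpa using (tendsto_pow_atTop_nhds_zero_of_lt_one hq0.le hq1).const_mul a
  have hw1 : ∑ j, w j = 1 := by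
    have h : Tendsto (fun k => ∑ j, p k ⟨0, hn⟩ j) atTop (𝓝 (∑ j, w j)) :=
      tendsto_finsetSum _ fun j _ => tendsto_sub_nhds_zero_iff.1
        (squeeze_zero_norm (fun k => hp k ⟨0, hn⟩ j) (hgeom K))
    simp only [hp1] at h
    exact tendsto_nhds_unique h tendsto_const_nhds
  have hwpos : 0 < euclNorm w :=
    pos_of_mul_pos_right (one_pos.trans_le (one_le_sqrt_mul_euclNorm hw1)) (Real.sqrt_nonneg _)
  have hbound : ∀ i k, euclNorm ((euclNorm (Atilde A γbar X₀ k i))⁻¹ • Atilde A γbar X₀ k i -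
      (euclNorm w)⁻¹ • w) ≤ 2 * n * K * q ^ k := fun i k => by
    rw [Atilde_eq_leftProd, ← normalize_smul_of_pos (inv_pos.2 (hr k i)), mul_assoc _ K]
    exact euclNorm_normalize_sub_le_of_sum_eq_one (hp1 k i) hw1 (by positivity) (hp k i)
  refine ⟨(euclNorm w)⁻¹ • w, euclNorm_normalize hwpos,
    fun j => mul_pos (inv_pos.2 hwpos) (hw0 j), fun i => ?_, fun i k _ => hbound i k⟩
  exact tendsto_pi_nhds.2 fun j => tendsto_sub_nhds_zero_iff.1
    (squeeze_zero_norm (fun k => (abs_apply_le_euclNorm _ j).trans (hbound i k)) (hgeom _))
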